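/- arXiv:2302.06002 — 2 statements merged into one kernel-verified Lean document; each statement's English description precedes it below -/
import Mathlib

section
/- Let ρ be a 2×2 density matrix (positive semidefinite with trace 1) and let A, B be 2×2 Hermitian complex matrices neither of which is a scalar multiple of the identity. Set α = tr(ρA) and β = tr(ρB). If there exists ϑ ∈ ℝ such that cos ϑ · (A − αI)ρ + i sin ϑ · (B − βI)ρ = 0, then ρ is a pure state, i.e., there exists a unit vector ψ ∈ ℂ² with ρ = ψψ† (the rank-one orthogonal projection onto ψ). -/
open Matrix ComplexOrder

/-- A Hermitian matrix `X` and an `I`-multiple of a Hermitian matrix `Y` sum to zero only if both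
vanish. -/
lemma Matrix.IsHermitian.eq_zero_of_add_I_smul_eq_zero {n : Type*} {X Y : Matrix n n ℂ}
    (hX : X.IsHermitian) (hY : Y.IsHermitian) (h : X + Complex.I • Y = 0) : X = 0 ∧ Y = 0 := by
  have h' : X - Complex.I • Y = 0 := by
    have := congrArg (fun M : Matrix n n ℂ => Mᴴ) h
    simpa [conjTranspose_add, conjTranspose_smul, hX.eq, hY.eq, sub_eq_add_neg] using this
  have hX0 : X = 0 := by
    have h2 : (2 : ℂ) • X = 0 := by
      rw [two_smul]
      calc X + X = (X + Complex.I • Y) + (X - Complex.I • Y) := by abel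
        _ = 0 := by rw [h, h', add_zero]
    exact (smul_eq_zero.mp h2).resolve_left two_ne_zero
  refine ⟨hX0, ?_⟩
  rw [hX0, zero_add] at h
  exact (smul_eq_zero.mp h).resolve_left Complex.I_ne_zero

/-- A singular positive semidefinite 2×2 matrix has the form `ψψ†`. -/
lemma Matrix.PosSemidef.exists_eq_vecMulVec_of_det_eq_zero {ρ : Matrix (Fin 2) (Fin 2) ℂ}
    (hρ : ρ.PosSemidef) (hdet : ρ.det = 0) : ∃ ψ : Fin 2 → ℂ, ρ = vecMulVec ψ (star ψ) := by
  have h01 : ρ 0 1 = star (ρ 1 0) := (hρ.isHermitian.apply 0 1).symm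
  obtain ⟨r, hr, ha⟩ := RCLike.nonneg_iff_exists_ofReal.mp (hρ.diag_nonneg (i := 0))
  obtain ⟨t, ht, hd⟩ := RCLike.nonneg_iff_exists_ofReal.mp (hρ.diag_nonneg (i := 1))
  have sq_sqrt : ∀ x : ℝ, 0 ≤ x → (√x : ℂ) * √x = x := fun x hx => by
    rw [← Complex.ofReal_mul, Real.mul_self_sqrt hx]
  rw [det_fin_two, h01, ← ha, ← hd] at hdet
  rcases eq_or_ne r 0 with rfl | hr0
  · have h10 : ρ 1 0 = 0 := by simpa using hdet
    refine ⟨![0, (√t : ℂ)], ?_⟩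
    ext i j
    fin_cases i <;> fin_cases j <;> simp [vecMulVec_apply, h01, h10, ← ha, ← hd, sq_sqrt t ht]
  · have hs : (√r : ℂ) ≠ 0 := by
      exact_mod_cast (Real.sqrt_pos.mpr (lt_of_le_of_ne hr hr0.symm)).ne'
    refine ⟨![(√r : ℂ), ρ 1 0 / √r], ?_⟩
    ext i j
    fin_cases i <;> fin_cases j
    · simp [vecMulVec_apply, ← ha, sq_sqrt r hr]
    · simp [vecMulVec_apply, h01, mul_div_cancel₀, hs]
    · simp [vecMulVec_apply, hs]
    · have key : (t : ℂ) = ρ 1 0 / √r * (star (ρ 1 0) / √r) := by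
        rw [div_mul_div_comm, sq_sqrt r hr, eq_div_iff (by exact_mod_cast hr0)]
        linear_combination hdet
      simpa [vecMulVec_apply, ← hd] using key

/-- If `A, B` are non-scalar 2×2 Hermitian matrices and
`cos ϑ·(A − αI)ρ + i sin ϑ·(B − βI)ρ = 0` for some `ϑ`, then the density
matrix `ρ` is a pure state. -/
theorem saturation_implies_pure_qubit
    (ρ A B : Matrix (Fin 2) (Fin 2) ℂ)
    (hρ : ρ.PosSemidef) (hρtr : ρ.trace = 1)
    (hA : A.IsHermitian) (hB : B.IsHermitian)
    (hAns : ¬∃ c : ℂ, A = c • (1 : Matrix (Fin 2) (Fin 2) ℂ))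
    (hBns : ¬∃ c : ℂ, B = c • (1 : Matrix (Fin 2) (Fin 2) ℂ))
    (α β : ℝ)
    (hα : (α : ℂ) = (ρ * A).trace)
    (hβ : (β : ℂ) = (ρ * B).trace)
    (hsat : ∃ ϑ : ℝ,
      (Real.cos ϑ : ℂ) • ((A - (α : ℂ) • (1 : Matrix (Fin 2) (Fin 2) ℂ)) * ρ) +
        ((Real.sin ϑ : ℂ) * Complex.I) •
          ((B - (β : ℂ) • (1 : Matrix (Fin 2) (Fin 2) ℂ)) * ρ) = 0) :
    ∃ ψ : Fin 2 → ℂ, star ψ ⬝ᵥ ψ = 1 ∧ ρ = vecMulVec ψ (star ψ) := by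
  obtain ⟨ϑ, hϑ⟩ := hsat
  have hdet : ρ.det = 0 := by
    by_contra hne
    have hunit : IsUnit ρ := (isUnit_iff_isUnit_det ρ).mpr (isUnit_iff_ne_zero.mpr hne)
    have herm : ∀ (M : Matrix (Fin 2) (Fin 2) ℂ) (c x : ℝ), M.IsHermitian →
        ((c : ℂ) • (M - (x : ℂ) • (1 : Matrix (Fin 2) (Fin 2) ℂ))).IsHermitian := by
      intro M c x hM
      simp [IsHermitian, conjTranspose_smul, hM.eq]
    have hzero : (Real.cos ϑ : ℂ) • (A - (α : ℂ) • (1 : Matrix (Fin 2) (Fin 2) ℂ)) +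
        Complex.I • ((Real.sin ϑ : ℂ) • (B - (β : ℂ) • (1 : Matrix (Fin 2) (Fin 2) ℂ))) = 0 := by
      refine hunit.mul_left_eq_zero.mp ?_
      rw [add_mul, smul_mul_assoc, smul_smul, smul_mul_assoc, mul_comm Complex.I, hϑ]
    obtain ⟨h1, h2⟩ := (herm A _ α hA).eq_zero_of_add_I_smul_eq_zero (herm B _ β hB) hzero
    have hc := (smul_eq_zero.mp h1).resolve_right fun h => hAns ⟨α, sub_eq_zero.mp h⟩
    have hs := (smul_eq_zero.mp h2).resolve_right fun h => hBns ⟨β, sub_eq_zero.mp h⟩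
    have hone := Real.sin_sq_add_cos_sq ϑ
    simp [Complex.ofReal_eq_zero.mp hc, Complex.ofReal_eq_zero.mp hs] at hone
  obtain ⟨ψ, hψ⟩ := hρ.exists_eq_vecMulVec_of_det_eq_zero hdet
  refine ⟨ψ, ?_, hψ⟩
  rw [dotProduct_comm, ← trace_vecMulVec, ← hψ, hρtr]
end

section
/- Let A, B be 2×2 Hermitian complex matrices and let ρ be a 2×2 density matrix (positive semidefinite with trace 1), with α = tr(ρA) and β = tr(ρB). If (A − αI)ρ = 0 and (B − βI)ρ = 0, then AB = BA. Consequently, if AB ≠ BA, then Δ(A)² + Δ(B)² > 0, where Δ(A)² = tr(ρA²) − α² and Δ(B)² = tr(ρB²) − β². -/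
open Matrix ComplexOrder

/-- A traceless skew-Hermitian `2 × 2` complex matrix with zero determinant vanishes. -/
theorem eq_zero_of_conjTranspose_eq_neg_of_trace_of_det {K : Matrix (Fin 2) (Fin 2) ℂ}
    (hK : Kᴴ = -K) (htr : K.trace = 0) (hdet : K.det = 0) : K = 0 := by
  have hsq : K * K = 0 := by
    rw [trace_fin_two] at htr
    rw [det_fin_two] at hdet
    have h11 : K 1 1 = -K 0 0 := by linear_combination htr
    rw [h11] at hdet
    ext i j
    fin_cases i <;> fin_cases j <;> simp [mul_apply, Fin.sum_univ_two, h11]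
    · linear_combination -hdet
    · ring
    · ring
    · linear_combination -hdet
  rw [← conjTranspose_mul_self_eq_zero, hK, neg_mul, hsq, neg_zero]

/-- Hermitian `2 × 2` matrices annihilating a common nonzero matrix commute. -/
theorem Matrix.IsHermitian.commute_of_mul_eq_zero {M N ρ : Matrix (Fin 2) (Fin 2) ℂ}
    (hM : M.IsHermitian) (hN : N.IsHermitian) (hρ : ρ ≠ 0)
    (hMρ : M * ρ = 0) (hNρ : N * ρ = 0) : Commute M N := by
  refine sub_eq_zero.mp (eq_zero_of_conjTranspose_eq_neg_of_trace_of_det ?_ ?_ ?_)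
  · simp [conjTranspose_mul, hM.eq, hN.eq]
  · rw [trace_sub, trace_mul_comm, sub_self]
  · by_contra hdet
    have hunit : IsUnit (M * N - N * M).det := isUnit_iff_ne_zero.mpr hdet
    apply hρ
    rw [← nonsing_inv_mul_cancel_left (M * N - N * M) ρ hunit, sub_mul, mul_assoc, mul_assoc,
      hMρ, hNρ]
    simp

open scoped MatrixOrder Matrix.Norms.L2Operator in
/-- If the nonnegative matrix `Mᴴ * ρ * M` has zero trace then `ρ * M = 0`. -/
theorem Matrix.PosSemidef.mul_eq_zero_of_trace_conj_eq_zero {n : Type*} [Fintype n]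
    {ρ M : Matrix n n ℂ} (hρ : ρ.PosSemidef) (h : (Mᴴ * ρ * M).trace = 0) : ρ * M = 0 := by
  classical
  obtain ⟨C, rfl⟩ := CStarAlgebra.nonneg_iff_eq_star_mul_self.mp hρ.nonneg
  rw [star_eq_conjTranspose] at *
  have hCM : C * M = 0 := by
    rw [← trace_conjTranspose_mul_self_eq_zero_iff, conjTranspose_mul, ← h]
    simp only [mul_assoc]
  rw [mul_assoc, hCM, mul_zero]

/-- The variance of `A` in the state `ρ` is the trace of `ρ` conjugated by `A - α`. -/
theorem trace_conj_sub_smul_one {n : Type*} [Fintype n] [DecidableEq n]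
    {ρ A : Matrix n n ℂ} (hρtr : ρ.trace = 1) (hA : A.IsHermitian) {α : ℝ}
    (hα : (α : ℂ) = (ρ * A).trace) :
    ((A - (α : ℂ) • (1 : Matrix n n ℂ))ᴴ * ρ * (A - (α : ℂ) • 1)).trace =
      (ρ * (A * A)).trace - (α : ℂ) ^ 2 := by
  have hM : (A - (α : ℂ) • (1 : Matrix n n ℂ))ᴴ = A - (α : ℂ) • 1 := by
    simp [hA.eq]
  rw [hM, trace_mul_cycle, trace_mul_comm]
  simp only [mul_sub, sub_mul, mul_smul_comm, smul_mul_assoc, mul_one, one_mul, trace_sub,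
    trace_smul, smul_eq_mul, hρtr, ← hα]
  ring

/-- The variance of an observable is nonnegative. -/
theorem variance_nonneg {n : Type*} [Fintype n] [DecidableEq n]
    {ρ A : Matrix n n ℂ} (hρ : ρ.PosSemidef) (hρtr : ρ.trace = 1) (hA : A.IsHermitian) {α : ℝ}
    (hα : (α : ℂ) = (ρ * A).trace) : 0 ≤ (ρ * (A * A)).trace.re - α ^ 2 := by
  have h := (hρ.conjTranspose_mul_mul_same (A - (α : ℂ) • (1 : Matrix n n ℂ))).trace_nonneg
  rw [trace_conj_sub_smul_one hρtr hA hα] at h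
  simpa [← Complex.ofReal_pow] using (Complex.le_def.mp h).1

/-- An observable with zero variance satisfies `(A - α) * ρ = 0`. -/
theorem sub_smul_one_mul_eq_zero_of_variance_eq_zero {n : Type*} [Fintype n] [DecidableEq n]
    {ρ A : Matrix n n ℂ} (hρ : ρ.PosSemidef) (hρtr : ρ.trace = 1) (hA : A.IsHermitian) {α : ℝ}
    (hα : (α : ℂ) = (ρ * A).trace) (hvar : (ρ * (A * A)).trace.re - α ^ 2 = 0) :
    (A - (α : ℂ) • (1 : Matrix n n ℂ)) * ρ = 0 := by
  have h := (hρ.conjTranspose_mul_mul_same (A - (α : ℂ) • (1 : Matrix n n ℂ))).trace_nonneg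
  have hzero := hρ.mul_eq_zero_of_trace_conj_eq_zero (M := A - (α : ℂ) • (1 : Matrix n n ℂ)) <| by
    refine Complex.ext ?_ (Complex.le_def.mp h).2.symm
    rw [trace_conj_sub_smul_one hρtr hA hα]
    simpa [← Complex.ofReal_pow] using hvar
  simpa [conjTranspose_mul, hA.eq, hρ.isHermitian.eq] using congrArg conjTranspose hzero

/-- For 2×2 Hermitian matrices and a qubit density matrix:
if `(A − αI)ρ = 0` and `(B − βI)ρ = 0` then `A` and `B` commute;
consequently, if `A` and `B` do not commute then `Δ(A)² + Δ(B)² > 0`. -/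
theorem qubit_commute_of_deviations_vanish
    (ρ A B : Matrix (Fin 2) (Fin 2) ℂ)
    (hρ : ρ.PosSemidef) (hρtr : ρ.trace = 1)
    (hA : A.IsHermitian) (hB : B.IsHermitian)
    (α β : ℝ)
    (hα : (α : ℂ) = (ρ * A).trace)
    (hβ : (β : ℂ) = (ρ * B).trace) :
    ((A - (α : ℂ) • (1 : Matrix (Fin 2) (Fin 2) ℂ)) * ρ = 0 ∧
        (B - (β : ℂ) • (1 : Matrix (Fin 2) (Fin 2) ℂ)) * ρ = 0 → A * B = B * A) ∧
    (A * B ≠ B * A →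
      0 < (((ρ * (A * A)).trace).re - α ^ 2) + (((ρ * (B * B)).trace).re - β ^ 2)) := by
  have hcomm : (A - (α : ℂ) • (1 : Matrix (Fin 2) (Fin 2) ℂ)) * ρ = 0 ∧
      (B - (β : ℂ) • (1 : Matrix (Fin 2) (Fin 2) ℂ)) * ρ = 0 → A * B = B * A := by
    rintro ⟨hAρ, hBρ⟩
    have hρ0 : ρ ≠ 0 := by
      rintro rfl
      simp at hρtr
    have hAh : (A - (α : ℂ) • (1 : Matrix (Fin 2) (Fin 2) ℂ)).IsHermitian := by
      simp [IsHermitian, hA.eq]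
    have hBh : (B - (β : ℂ) • (1 : Matrix (Fin 2) (Fin 2) ℂ)).IsHermitian := by
      simp [IsHermitian, hB.eq]
    have h := (hAh.commute_of_mul_eq_zero hBh hρ0 hAρ hBρ).eq
    simp only [mul_sub, sub_mul, mul_smul_comm, smul_mul_assoc, mul_one, one_mul,
      smul_sub, smul_comm (β : ℂ) (α : ℂ) (1 : Matrix (Fin 2) (Fin 2) ℂ)] at h
    rw [← sub_eq_zero] at h ⊢
    rw [← h]
    abel
  refine ⟨hcomm, fun hne => ?_⟩
  have hA0 := variance_nonneg hρ hρtr hA hα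
  have hB0 := variance_nonneg hρ hρtr hB hβ
  by_contra! hle
  exact hne <| hcomm
    ⟨sub_smul_one_mul_eq_zero_of_variance_eq_zero hρ hρtr hA hα (by linarith),
      sub_smul_one_mul_eq_zero_of_variance_eq_zero hρ hρtr hB hβ (by linarith)⟩
end
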